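/- arXiv:1910.07975 — 7 statements merged into one kernel-verified Lean document; each statement's English description precedes it below -/
import Mathlib

section
/- Let p > -1 and 0 ≤ a ≤ b be real numbers, and let f : [a,b] → ℝ be continuously differentiable. Then ∫_a^b x^p f(x)² dx ≤ 4(p+1)^{-2} ∫_a^b x^{p+2} f′(x)² dx + 2(p+1)^{-1} b^{p+1} f(b)². -/
/-- Hardy inequality, case `p > -1`: for `0 ≤ a ≤ b` and `f` continuously
differentiable on `[a, b]`,
`∫_a^b x^p f(x)² dx ≤ 4(p+1)⁻² ∫_a^b x^(p+2) f'(x)² dx + 2(p+1)⁻¹ b^(p+1) f(b)²`. -/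
theorem hardy_inequality_p_gt_neg_one
    (p a b : ℝ) (hp : -1 < p) (ha : 0 ≤ a) (hab : a ≤ b)
    (f f' : ℝ → ℝ)
    (hf : ∀ x ∈ Set.Icc a b, HasDerivAt f (f' x) x)
    (hf' : ContinuousOn f' (Set.Icc a b)) :
    (∫ x in a..b, x ^ p * f x ^ 2) ≤
      4 / (p + 1) ^ 2 * (∫ x in a..b, x ^ (p + 2) * f' x ^ 2)
        + 2 / (p + 1) * b ^ (p + 1) * f b ^ 2 := by
  have hq : 0 < p + 1 := by linarith
  have hfc : ContinuousOn f (Set.Icc a b) := fun x hx => (hf x hx).continuousAt.continuousWithinAt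
  have hp_int : IntervalIntegrable (fun x : ℝ => x ^ p) MeasureTheory.volume a b :=
    intervalIntegral.intervalIntegrable_rpow' hp
  have hpow (r : ℝ) (hr : 0 ≤ r) : ContinuousOn (fun x : ℝ => x ^ r) (Set.Icc a b) :=
    (Real.continuous_rpow_const hr).continuousOn
  have int_left : IntervalIntegrable (fun x => x ^ p * f x ^ 2) MeasureTheory.volume a b :=
    hp_int.mul_continuousOn (by rw [Set.uIcc_of_le hab]; exact hfc.pow 2)
  have int_right : IntervalIntegrable (fun x => x ^ (p + 2) * f' x ^ 2)
      MeasureTheory.volume a b :=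
    ((hpow (p + 2) (by linarith)).mul (hf'.pow 2)).intervalIntegrable_of_Icc hab
  have int_cross : IntervalIntegrable (fun x => x ^ (p + 1) * (2 * f x * f' x))
      MeasureTheory.volume a b :=
    ((hpow (p + 1) hq.le).mul ((continuousOn_const.mul hfc).mul hf')).intervalIntegrable_of_Icc hab
  have int_deriv := (int_left.const_mul (p + 1)).add int_cross
  have ftc : (∫ x in a..b, ((p + 1) * (x ^ p * f x ^ 2) + x ^ (p + 1) * (2 * f x * f' x))) =
      b ^ (p + 1) * f b ^ 2 - a ^ (p + 1) * f a ^ 2 := by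
    refine intervalIntegral.integral_eq_sub_of_hasDerivAt_of_le
      (f := fun x => x ^ (p + 1) * f x ^ 2) hab ((hpow (p + 1) hq.le).mul (hfc.pow 2)) ?_ int_deriv
    intro x hx
    have hx0 : x ≠ 0 := (ha.trans_lt hx.1).ne'
    refine ((Real.hasDerivAt_rpow_const (p := p + 1) (Or.inl hx0)).mul
      ((hf x (Set.Ioo_subset_Icc_self hx)).pow 2)).congr_deriv ?_
    simp only [add_sub_cancel_right, Pi.pow_apply]
    push_cast
    ring
  have mono : (∫ x in a..b, x ^ p * f x ^ 2) ≤
      ∫ x in a..b, (2 / (p + 1) *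
          ((p + 1) * (x ^ p * f x ^ 2) + x ^ (p + 1) * (2 * f x * f' x)) +
        4 / (p + 1) ^ 2 * (x ^ (p + 2) * f' x ^ 2)) := by
    refine intervalIntegral.integral_mono_on_of_le_Ioo hab int_left
      ((int_deriv.const_mul _).add (int_right.const_mul _)) ?_
    intro x hx
    have hx0 : 0 < x := ha.trans_lt hx.1
    have h1 : x ^ (p + 1) = x ^ p * x := Real.rpow_add_one hx0.ne' p
    have h2 : x ^ (p + 2) = x ^ p * x ^ 2 := by
      rw [Real.rpow_add hx0, Real.rpow_two]
    have key : 0 ≤ x ^ p * (f x + 2 / (p + 1) * (x * f' x)) ^ 2 := by positivity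
    rw [h1, h2, ← sub_nonneg]
    refine key.trans_eq ?_
    field_simp
    ring
  rw [intervalIntegral.integral_add (int_deriv.const_mul _) (int_right.const_mul _),
    intervalIntegral.integral_const_mul, intervalIntegral.integral_const_mul, ftc] at mono
  have boundary : 0 ≤ 2 / (p + 1) * (a ^ (p + 1) * f a ^ 2) := by positivity
  linarith
end

section
/- Let p < -1 and 0 < a ≤ b be real numbers, and let f : [a,b] → ℝ be continuously differentiable. Then ∫_a^b x^p f(x)² dx ≤ 4(p+1)^{-2} ∫_a^b x^{p+2} f′(x)² dx + 2|p+1|^{-1} a^{p+1} f(a)². -/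
/-- Hardy inequality, case `p < -1`: for `0 < a ≤ b` and `f` continuously
differentiable on `[a, b]`,
`∫_a^b x^p f(x)² dx ≤ 4(p+1)⁻² ∫_a^b x^(p+2) f'(x)² dx + 2|p+1|⁻¹ a^(p+1) f(a)²`. -/
theorem hardy_inequality_p_lt_neg_one
    (p a b : ℝ) (hp : p < -1) (ha : 0 < a) (hab : a ≤ b)
    (f f' : ℝ → ℝ)
    (hf : ∀ x ∈ Set.Icc a b, HasDerivAt f (f' x) x)
    (hf' : ContinuousOn f' (Set.Icc a b)) :
    (∫ x in a..b, x ^ p * f x ^ 2) ≤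
      4 / (p + 1) ^ 2 * (∫ x in a..b, x ^ (p + 2) * f' x ^ 2)
        + 2 / |p + 1| * a ^ (p + 1) * f a ^ 2 := by
  have hq : p + 1 < 0 := by linarith
  have hpos : ∀ x ∈ Set.Icc a b, 0 < x := fun x hx => ha.trans_le hx.1
  have hpow (r : ℝ) : ContinuousOn (fun x : ℝ => x ^ r) (Set.Icc a b) := fun x hx =>
    (Real.continuousAt_rpow_const x r (Or.inl (hpos x hx).ne')).continuousWithinAt
  have hfc : ContinuousOn f (Set.Icc a b) := fun x hx => (hf x hx).continuousAt.continuousWithinAt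
  have hI₁ : IntervalIntegrable (fun x => x ^ p * f x ^ 2) MeasureTheory.volume a b :=
    ((hpow p).mul (hfc.pow 2)).intervalIntegrable_of_Icc hab
  have hI₂ : IntervalIntegrable (fun x => x ^ (p + 2) * f' x ^ 2) MeasureTheory.volume a b :=
    ((hpow (p + 2)).mul (hf'.pow 2)).intervalIntegrable_of_Icc hab
  have hI₃ : IntervalIntegrable
      (fun x => (p + 1) * x ^ p * f x ^ 2 + x ^ (p + 1) * (2 * f x * f' x))
      MeasureTheory.volume a b :=
    (((continuousOn_const.mul (hpow p)).mul (hfc.pow 2)).add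
      ((hpow (p + 1)).mul ((continuousOn_const.mul hfc).mul hf'))).intervalIntegrable_of_Icc hab
  have hFTC : ∫ x in a..b, ((p + 1) * x ^ p * f x ^ 2 + x ^ (p + 1) * (2 * f x * f' x)) =
      b ^ (p + 1) * f b ^ 2 - a ^ (p + 1) * f a ^ 2 := by
    refine intervalIntegral.integral_eq_sub_of_hasDerivAt
      (f := fun x => x ^ (p + 1) * f x ^ 2) (fun x hx => ?_) hI₃
    rw [Set.uIcc_of_le hab] at hx
    have h₁ := Real.hasDerivAt_rpow_const (p := p + 1) (Or.inl (hpos x hx).ne')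
    rw [add_sub_cancel_right] at h₁
    exact (h₁.mul ((hf x hx).pow 2)).congr_deriv (by simp)
  have hmono := intervalIntegral.integral_mono_on hab hI₁
    ((hI₂.const_mul (4 / (p + 1) ^ 2)).add (hI₃.const_mul (2 / (p + 1)))) fun x hx => by
      have hx₀ := hpos x hx
      have e₁ : x ^ (p + 1) = x ^ p * x := Real.rpow_add_one hx₀.ne' p
      have e₂ : x ^ (p + 2) = x ^ p * x ^ 2 := mod_cast Real.rpow_add_natCast hx₀.ne' p 2
      have hsq : 0 ≤ x ^ p * (f x + 2 * x * f' x / (p + 1)) ^ 2 := by positivity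
      rw [e₁, e₂, ← sub_nonneg]
      convert hsq using 1
      field_simp [hq.ne]
      ring
  rw [intervalIntegral.integral_add (hI₂.const_mul _) (hI₃.const_mul _),
    intervalIntegral.integral_const_mul, intervalIntegral.integral_const_mul, hFTC] at hmono
  have hb : 2 / (p + 1) * (b ^ (p + 1) * f b ^ 2) ≤ 0 :=
    mul_nonpos_of_nonpos_of_nonneg (div_nonpos_of_nonneg_of_nonpos zero_le_two hq.le)
      (mul_nonneg (Real.rpow_nonneg (ha.le.trans hab) _) (sq_nonneg _))
  rw [abs_of_neg hq, div_neg]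
  linarith
end

section
/- Fix M > 0, let D(r) = (1 − M/r)² and let r_*(r) = r − M − M²/(r−M) + 2M·log((r−M)/M) for r > M. Then there exist constants C > 0 and R > max(2M, 2) such that for all r ≥ R: | 2·D(r)/r² + D(r)·r_*(r)·(d/dr)(D(r)/r²) | ≤ C·(log r)/r³. -/
/-- The derivative of `D(r) / r²`. -/
theorem hasDerivAt_one_sub_div_sq_div_sq (M : ℝ) {r : ℝ} (hr : r ≠ 0) :
    HasDerivAt (fun s : ℝ => (1 - M / s) ^ 2 / s ^ 2)
      (-2 * (r - M) * (r - 2 * M) / r ^ 5) r := by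
  have h := (((hasDerivAt_const r M).div (hasDerivAt_id r) hr).const_sub 1).pow 2
  refine (h.div (hasDerivAt_pow 2 r) (pow_ne_zero 2 hr)).congr_deriv ?_
  simp only [id, Pi.div_apply, Pi.pow_apply, Nat.add_one_sub_one, pow_one]
  field_simp
  ring

/-- The multiplier expression with its leading-order terms cancelled; `L` stands for the
logarithm in the tortoise coordinate. -/
theorem conformal_multiplier_expression_eq (M L : ℝ) {r : ℝ} (hr : r ≠ 0) (hrM : r - M ≠ 0) :
    2 * (1 - M / r) ^ 2 / r ^ 2
        + (1 - M / r) ^ 2 * (r - M - M ^ 2 / (r - M) + 2 * M * L)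
          * (-2 * (r - M) * (r - 2 * M) / r ^ 5)
      = 2 * (1 - M / r) ^ 2 * (4 * M * (r * (r - M)) - 2 * M * ((r - M) * (r - 2 * M)) * L)
        / r ^ 5 := by
  field_simp
  ring

/-- Leading-order cancellation near null infinity for the Morawetz conformal
multiplier: with `D(r) = (1 - M/r)²` and the exterior tortoise coordinate
`r_*`, one has `|2 D/r² + D r_* (D/r²)'| ≤ C (log r)/r³` for all large `r`. -/
theorem conformal_multiplier_cancellation_near_infinity
    (M : ℝ) (hM : 0 < M) :
    ∃ C > (0 : ℝ), ∃ R > max (2 * M) 2, ∀ r : ℝ, R ≤ r →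
      |2 * (1 - M / r) ^ 2 / r ^ 2
        + (1 - M / r) ^ 2 * (r - M - M ^ 2 / (r - M) + 2 * M * Real.log ((r - M) / M))
          * deriv (fun s => (1 - M / s) ^ 2 / s ^ 2) r|
      ≤ C * Real.log r / r ^ 3 := by
  refine ⟨12 * M + 4 * M * |Real.log M|, by positivity, max (2 * M) 2 + 1, lt_add_one _, ?_⟩
  intro r hr
  have hr2M : 2 * M < r := by linarith [le_max_left (2 * M) 2]
  have hr3 : 3 ≤ r := by linarith [le_max_right (2 * M) 2]
  have hr0 : 0 < r := by linarith
  have hrM : 0 < r - M := by linarith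
  have hlog : 1 ≤ Real.log r := by
    rw [Real.le_log_iff_exp_le hr0]
    linarith [Real.exp_one_lt_d9]
  rw [(hasDerivAt_one_sub_div_sq_div_sq M hr0.ne').deriv,
    conformal_multiplier_expression_eq M _ hr0.ne' hrM.ne']
  have hL0 : 0 ≤ Real.log ((r - M) / M) :=
    Real.log_nonneg ((one_le_div hM).2 (by linarith))
  have hL : Real.log ((r - M) / M) ≤ (1 + |Real.log M|) * Real.log r := by
    rw [Real.log_div hrM.ne' hM.ne']
    have h₁ : Real.log (r - M) ≤ Real.log r := Real.log_le_log hrM (by linarith)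
    have h₂ := neg_abs_le (Real.log M)
    have h₃ := le_mul_of_one_le_right (abs_nonneg (Real.log M)) hlog
    linarith
  set L := Real.log ((r - M) / M)
  have hD : (1 - M / r) ^ 2 ≤ 1 := by
    have h₁ : M / r ≤ 1 := (div_le_one hr0).2 (by linarith)
    have h₂ : 0 ≤ M / r := by positivity
    exact pow_le_one₀ (by linarith) (by linarith)
  have hp : r * (r - M) ≤ r ^ 2 := by nlinarith
  have hq : (r - M) * (r - 2 * M) ≤ r ^ 2 := by nlinarith
  have hq0 : 0 ≤ (r - M) * (r - 2 * M) := mul_nonneg hrM.le (by linarith)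
  have hbracket : |4 * M * (r * (r - M)) - 2 * M * ((r - M) * (r - 2 * M)) * L|
      ≤ (6 * M + 2 * M * |Real.log M|) * Real.log r * r ^ 2 :=
    calc _ ≤ 4 * M * (r * (r - M)) + 2 * M * ((r - M) * (r - 2 * M)) * L := by
          have h₁ : 0 ≤ 4 * M * (r * (r - M)) := by positivity
          have h₂ : 0 ≤ 2 * M * ((r - M) * (r - 2 * M)) * L := by positivity
          rw [abs_le]
          constructor <;> linarith
      _ ≤ 4 * M * r ^ 2 * Real.log r
          + 2 * M * r ^ 2 * ((1 + |Real.log M|) * Real.log r) := by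
          refine add_le_add ?_ (by gcongr)
          exact (by gcongr : _ ≤ 4 * M * r ^ 2).trans
            (le_mul_of_one_le_right (by positivity) hlog)
      _ = _ := by ring
  rw [abs_div, abs_mul, abs_of_nonneg (by positivity : 0 ≤ 2 * (1 - M / r) ^ 2),
    abs_of_pos (by positivity : 0 < r ^ 5)]
  calc _ ≤ 2 * 1 * ((6 * M + 2 * M * |Real.log M|) * Real.log r * r ^ 2) / r ^ 5 := by
        gcongr
    _ = _ := by
        field_simp
        ring
end

section
/- Fix M > 0, let D(r) = (1 − M/r)² and let r_*(r) = r − M − M²/(r−M) + 2M·log((r−M)/M) for r > M. Then there exist constants C > 0 and δ ∈ (0,M) such that for all r ∈ (M, M+δ): | 2·D(r)/r² + D(r)·r_*(r)·(d/dr)(D(r)/r²) | ≤ C·(r−M)³·(1 + |log(r−M)|). -/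
/-- The derivative of `D/r²` for the extremal profile `D(r) = (1 - M/r)²`. -/
lemma hasDerivAt_extremal_profile_div_sq (M : ℝ) {r : ℝ} (hr : r ≠ 0) :
    HasDerivAt (fun s : ℝ => (1 - M / s) ^ 2 / s ^ 2)
      (2 * (r - M) * (2 * M - r) / r ^ 5) r := by
  have h := (((hasDerivAt_const r M).div (hasDerivAt_id r) hr).const_sub 1).pow 2
  have h2 := h.div ((hasDerivAt_id r).pow 2) (pow_ne_zero 2 hr)
  refine h2.congr_deriv ?_
  simp only [id, Pi.pow_apply, Pi.div_apply, Nat.cast_ofNat, Nat.add_one_sub_one, pow_one]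
  field_simp
  ring

/-- Closed form of the multiplier coefficient, with `L` in place of `log ((r - M)/M)`. -/
lemma conformal_multiplier_coefficient_eq (M L : ℝ) {r : ℝ} (hr : r ≠ 0) (hx : r - M ≠ 0) :
    2 * (1 - M / r) ^ 2 / r ^ 2
        + (1 - M / r) ^ 2 * (r - M - M ^ 2 / (r - M) + 2 * M * L)
          * (2 * (r - M) * (2 * M - r) / r ^ 5)
      = 4 * M / r ^ 6 * (r - M) ^ 3 * (2 + (2 * M - r) / r * L) := by
  field_simp
  ring

/-- Leading-order cancellation near the extremal event horizon for the Morawetz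
conformal multiplier: with `D(r) = (1 - M/r)²` and the exterior tortoise coordinate
`r_*`, one has `|2 D/r² + D r_* (D/r²)'| ≤ C (r-M)³ (1 + |log(r-M)|)` for `r`
slightly bigger than `M`. -/
theorem conformal_multiplier_cancellation_near_horizon
    (M : ℝ) (hM : 0 < M) :
    ∃ C > (0 : ℝ), ∃ δ ∈ Set.Ioo (0 : ℝ) M, ∀ r ∈ Set.Ioo M (M + δ),
      |2 * (1 - M / r) ^ 2 / r ^ 2
        + (1 - M / r) ^ 2 * (r - M - M ^ 2 / (r - M) + 2 * M * Real.log ((r - M) / M))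
          * deriv (fun s => (1 - M / s) ^ 2 / s ^ 2) r|
      ≤ C * (r - M) ^ 3 * (1 + |Real.log (r - M)|) := by
  refine ⟨4 * M / M ^ 6 * (2 + |Real.log M|), by positivity, M / 2,
    ⟨by linarith, by linarith⟩, ?_⟩
  rintro r ⟨h1, h2⟩
  have hr : 0 < r := hM.trans h1
  have hx : 0 < r - M := sub_pos.2 h1
  rw [(hasDerivAt_extremal_profile_div_sq M hr.ne').deriv,
    conformal_multiplier_coefficient_eq M _ hr.ne' hx.ne',
    Real.log_div hx.ne' hM.ne', abs_mul,
    abs_of_nonneg (by positivity : 0 ≤ 4 * M / r ^ 6 * (r - M) ^ 3)]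
  have hB : |(2 * M - r) / r| ≤ 1 := by
    rw [abs_div, abs_of_pos hr, div_le_one hr, abs_le]
    constructor <;> linarith
  have hL : |2 + (2 * M - r) / r * (Real.log (r - M) - Real.log M)|
      ≤ (2 + |Real.log M|) * (1 + |Real.log (r - M)|) := by
    calc _ ≤ |2| + |(2 * M - r) / r| * |Real.log (r - M) - Real.log M| := by
          rw [← abs_mul]; exact abs_add_le _ _
      _ ≤ 2 + 1 * (|Real.log (r - M)| + |Real.log M|) := by
          rw [abs_two]
          gcongr
          exact abs_sub _ _
      _ ≤ _ := by
          nlinarith [mul_nonneg (abs_nonneg (Real.log M)) (abs_nonneg (Real.log (r - M))),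
            abs_nonneg (Real.log (r - M))]
  calc _ ≤ 4 * M / M ^ 6 * (r - M) ^ 3 * ((2 + |Real.log M|) * (1 + |Real.log (r - M)|)) := by
        gcongr
    _ = _ := by ring
end

section
/- Fix M > 0, let D(r) = (1 − M/r)² and let r_*(r) = r − M + M²/(M−r) + 2M·log((M−r)/M) for 0 < r < M. Then there exist constants C > 0 and δ ∈ (0,M) such that for all r ∈ (M−δ, M): | 2·D(r)/r² + D(r)·r_*(r)·(d/dr)(D(r)/r²) | ≤ C·(M−r)³·(1 + |log(M−r)|). -/
/-- The derivative of `D/r²` for the extremal Reissner–Nordström factor `D = (1 - M/r)²`. -/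
theorem deriv_extremal_div_sq (M r : ℝ) (hr : r ≠ 0) :
    deriv (fun s => (1 - M / s) ^ 2 / s ^ 2) r = 2 * (r - M) * (2 * M - r) / r ^ 5 := by
  have h1 : HasDerivAt (fun s : ℝ => M / s) (-(M / r ^ 2)) r := by
    have h := (hasDerivAt_const r M).fun_div (hasDerivAt_id' r) hr
    rwa [zero_mul, mul_one, zero_sub, neg_div] at h
  have h2 := ((h1.const_sub 1).fun_pow 2).fun_div ((hasDerivAt_id' r).fun_pow 2) (pow_ne_zero 2 hr)
  rw [h2.deriv]
  simp only [Nat.cast_ofNat, Nat.add_one_sub_one, pow_one]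
  field_simp
  ring

/-- Exact form of the conformal multiplier coefficient after the leading-order cancellation,
with `L` standing for `log ((M - r)/M)`. -/
theorem conformal_multiplier_coeff_eq (M r L : ℝ) (hr : r ≠ 0) (hM : M - r ≠ 0) :
    2 * (1 - M / r) ^ 2 / r ^ 2
        + (1 - M / r) ^ 2 * (r - M + M ^ 2 / (M - r) + 2 * M * L)
          * (2 * (r - M) * (2 * M - r) / r ^ 5)
      = 2 * (M - r) ^ 3 / r ^ 7 * (-(4 * M * r) - 2 * M * (2 * M - r) * L) := by
  field_simp
  ring

/-- Leading-order cancellation near `r = M` in the black hole interior for the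
Morawetz conformal multiplier: with `D(r) = (1 - M/r)²` and the interior tortoise
coordinate `r_*`, one has `|2 D/r² + D r_* (D/r²)'| ≤ C (M-r)³ (1 + |log(M-r)|)` for
`r` slightly smaller than `M`. -/
theorem conformal_multiplier_cancellation_interior
    (M : ℝ) (hM : 0 < M) :
    ∃ C > (0 : ℝ), ∃ δ ∈ Set.Ioo (0 : ℝ) M, ∀ r ∈ Set.Ioo (M - δ) M,
      |2 * (1 - M / r) ^ 2 / r ^ 2
        + (1 - M / r) ^ 2 * (r - M + M ^ 2 / (M - r) + 2 * M * Real.log ((M - r) / M))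
          * deriv (fun s => (1 - M / s) ^ 2 / s ^ 2) r|
      ≤ C * (M - r) ^ 3 * (1 + |Real.log (M - r)|) := by
  refine ⟨2 / (M / 2) ^ 7 * (M ^ 2 * (7 + 3 * |Real.log M|)), by positivity, M / 2,
    ⟨by linarith, by linarith⟩, ?_⟩
  rintro r ⟨hr1, hr2⟩
  have hr : M / 2 < r := by linarith
  have hr0 : 0 < r := by linarith
  have hx : 0 < M - r := by linarith
  rw [deriv_extremal_div_sq M r hr0.ne', conformal_multiplier_coeff_eq M r _ hr0.ne' hx.ne',
    Real.log_div hx.ne' hM.ne', abs_mul, abs_of_pos (show 0 < 2 * (M - r) ^ 3 / r ^ 7 by positivity)]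
  set a := Real.log (M - r)
  set b := Real.log M
  have hbracket : |-(4 * M * r) - 2 * M * (2 * M - r) * (a - b)|
      ≤ M ^ 2 * (7 + 3 * |b|) * (1 + |a|) := by
    have hcoef : 2 * M * (2 * M - r) ≤ 3 * M ^ 2 := by nlinarith
    have hpos : 0 ≤ 2 * M * (2 * M - r) := mul_nonneg (by linarith) (by linarith)
    calc |-(4 * M * r) - 2 * M * (2 * M - r) * (a - b)|
        ≤ |-(4 * M * r)| + |2 * M * (2 * M - r) * (a - b)| := abs_sub _ _
      _ = 4 * M * r + 2 * M * (2 * M - r) * |a - b| := by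
          rw [abs_neg, abs_of_pos (show 0 < 4 * M * r by positivity), abs_mul, abs_of_nonneg hpos]
      _ ≤ 4 * M ^ 2 + 3 * M ^ 2 * (|a| + |b|) := by
          refine add_le_add (by nlinarith) ?_
          exact mul_le_mul hcoef (abs_sub _ _) (abs_nonneg _) (by positivity)
      _ ≤ M ^ 2 * (7 + 3 * |b|) * (1 + |a|) := by
          have : 0 ≤ M ^ 2 * (3 + 4 * |a| + 3 * (|a| * |b|)) := by positivity
          linarith
  calc 2 * (M - r) ^ 3 / r ^ 7 * |-(4 * M * r) - 2 * M * (2 * M - r) * (a - b)|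
      ≤ 2 * (M - r) ^ 3 / (M / 2) ^ 7 * (M ^ 2 * (7 + 3 * |b|) * (1 + |a|)) := by gcongr
    _ = 2 / (M / 2) ^ 7 * (M ^ 2 * (7 + 3 * |b|)) * (M - r) ^ 3 * (1 + |a|) := by ring
end

section
/- Fix M > 0, let D(r) = (1 − M/r)² and let r_*(r) = r − M − M²/(r−M) + 2M·log((r−M)/M) for r > M. Then there exist constants C > 0 and R > max(2M, 2) such that for all r ≥ R one has r_*(r) ≥ 1 and | D(r)/r² − 1/r_*(r)² | ≤ C·(log r)/r³. -/
theorem abs_one_div_sq_sub_one_div_sq_le {r s t B : ℝ} (hr : 0 < r) (hs : r / 2 ≤ s)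
    (ht : r ≤ t) (hB : |t - s| ≤ B) :
    |1 / t ^ 2 - 1 / s ^ 2| ≤ 6 * B / r ^ 3 := by
  have hs0 : 0 < s := by linarith
  have ht0 : 0 < t := by linarith
  have hB0 : 0 ≤ B := (abs_nonneg _).trans hB
  have hfactor : 1 / t ^ 2 - 1 / s ^ 2 = -((t - s) * (1 / (s * t ^ 2) + 1 / (s ^ 2 * t))) := by
    field_simp
    ring
  have h₁ : 1 / (s * t ^ 2) ≤ 1 / (r / 2 * r ^ 2) := by gcongr
  have h₂ : 1 / (s ^ 2 * t) ≤ 1 / ((r / 2) ^ 2 * r) := by gcongr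
  have hsum : 1 / (r / 2 * r ^ 2) + 1 / ((r / 2) ^ 2 * r) = 6 / r ^ 3 := by
    field_simp
    norm_num
  rw [hfactor, abs_neg, abs_mul,
    abs_of_nonneg (by positivity : 0 ≤ 1 / (s * t ^ 2) + 1 / (s ^ 2 * t))]
  calc |t - s| * (1 / (s * t ^ 2) + 1 / (s ^ 2 * t)) ≤ B * (6 / r ^ 3) := by
        gcongr
        linarith
    _ = 6 * B / r ^ 3 := by ring

/-- Expansion `D r⁻² = 1/r_*² + O(r⁻³) log r` near null infinity: with
`D(r) = (1 - M/r)²` and the exterior tortoise coordinate `r_*`, for all large `r`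
one has `r_*(r) ≥ 1` and `|D(r)/r² - 1/r_*(r)²| ≤ C (log r)/r³`. -/
theorem D_div_rsq_expansion_near_infinity
    (M : ℝ) (hM : 0 < M) :
    ∃ C > (0 : ℝ), ∃ R > max (2 * M) 2, ∀ r : ℝ, R ≤ r →
      1 ≤ r - M - M ^ 2 / (r - M) + 2 * M * Real.log ((r - M) / M) ∧
      |(1 - M / r) ^ 2 / r ^ 2
          - 1 / (r - M - M ^ 2 / (r - M) + 2 * M * Real.log ((r - M) / M)) ^ 2|
        ≤ C * Real.log r / r ^ 3 := by
  refine ⟨6 * (2 * M * (3 + |Real.log M|)), by positivity, 4 * M + 4,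
    max_lt (by linarith) (by linarith), fun r hr => ?_⟩
  have hr0 : 0 < r := by linarith
  have hx : 0 < r - M := by linarith
  have hMx : M ^ 2 / (r - M) ≤ M := by
    rw [div_le_iff₀ hx]
    nlinarith
  have hMx0 : 0 ≤ M ^ 2 / (r - M) := by positivity
  have hlog_nonneg : 0 ≤ Real.log ((r - M) / M) :=
    Real.log_nonneg (by rw [le_div_iff₀ hM]; linarith)
  have hlog_le : Real.log ((r - M) / M) ≤ Real.log r + |Real.log M| := by
    rw [Real.log_div hx.ne' hM.ne']
    have := Real.log_le_log hx (by linarith : r - M ≤ r)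
    linarith [neg_abs_le (Real.log M)]
  have hlog_one : 1 ≤ Real.log r := by
    rw [Real.le_log_iff_exp_le hr0]
    linarith [Real.exp_one_lt_d9]
  have hD : (1 - M / r) ^ 2 / r ^ 2 = 1 / (r ^ 2 / (r - M)) ^ 2 := by
    field_simp
  have ht : r ^ 2 / (r - M) = r + M + M ^ 2 / (r - M) := by
    field_simp
    ring
  have hMlog : 0 ≤ 2 * M * Real.log ((r - M) / M) := by positivity
  have hMlog_le : 2 * M * Real.log ((r - M) / M) ≤ 2 * M * (Real.log r + |Real.log M|) := by
    gcongr
  have hM_le : M ≤ M * Real.log r := le_mul_of_one_le_right hM.le hlog_one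
  have hMabs : M * |Real.log M| ≤ M * |Real.log M| * Real.log r :=
    le_mul_of_one_le_right (by positivity) hlog_one
  have hMabs0 : 0 ≤ M * |Real.log M| := by positivity
  refine ⟨by linarith, ?_⟩
  rw [hD, mul_assoc 6]
  refine abs_one_div_sq_sub_one_div_sq_le hr0 (by linarith) (by linarith) ?_
  rw [ht, abs_le]
  constructor <;> linarith
end

section
/- Fix M > 0, let D(r) = (1 − M/r)² and let r_*(r) = r − M − M²/(r−M) + 2M·log((r−M)/M) for r > M. Then there exist constants C > 0 and δ ∈ (0,M) such that for all r ∈ (M, M+δ) one has r_*(r) ≤ −1 and | D(r)/r² − 1/r_*(r)² | ≤ C·(r−M)³·(1 + |log(r−M)|). -/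
/-- Algebraic core of the comparison of `x² / (M + x)⁴` with `1 / R²`, where
`R = M² / x - x - 2 M L` and `L ≤ 0` is arbitrary. -/
lemma abs_sq_div_sub_one_div_sq_le {M x L : ℝ} (hM : 0 < M) (hx : 0 < x) (hxM : x ≤ M / 2)
    (hL : L ≤ 0) :
    M ^ 2 / (2 * x) ≤ M ^ 2 / x - x - 2 * M * L ∧
      |(x / (M + x) ^ 2) ^ 2 - (1 / (M ^ 2 / x - x - 2 * M * L)) ^ 2|
        ≤ 24 / M ^ 5 * x ^ 3 * (1 + |L|) := by
  have hR : M ^ 2 / (2 * x) ≤ M ^ 2 / x - x - 2 * M * L := by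
    have h1 : M ^ 2 / x = M ^ 2 / (2 * x) + M ^ 2 / (2 * x) := by field_simp; ring
    have h2 : x ≤ M ^ 2 / (2 * x) := by
      rw [le_div_iff₀ (by positivity)]
      nlinarith
    have h3 : M * L ≤ 0 := mul_nonpos_of_nonneg_of_nonpos hM.le hL
    linarith
  refine ⟨hR, ?_⟩
  set R := M ^ 2 / x - x - 2 * M * L with hRdef
  have hR0 : 0 < R := lt_of_lt_of_le (by positivity) hR
  have hxR : x * R = M ^ 2 - x ^ 2 - 2 * M * x * L := by
    rw [hRdef]; field_simp
  have hMx : M ^ 2 ≤ (M + x) ^ 2 := by gcongr; linarith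
  have hdiff : |x / (M + x) ^ 2 - 1 / R| ≤ 8 / M ^ 3 * x ^ 2 * (1 + |L|) := by
    have h : x / (M + x) ^ 2 - 1 / R
        = (x * R - (M + x) ^ 2) / ((M + x) ^ 2 * R) := by
      have : M + x ≠ 0 := by positivity
      field_simp
    have hnum : |x * R - (M + x) ^ 2| ≤ 4 * M * x * (1 + |L|) := by
      have hMxpos : 0 < M * x := by positivity
      rw [hxR, abs_of_nonpos hL, abs_le]
      constructor <;> nlinarith [mul_nonneg hMxpos.le (neg_nonneg.2 hL)]
    rw [h, abs_div, abs_of_pos (by positivity : 0 < (M + x) ^ 2 * R)]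
    calc |x * R - (M + x) ^ 2| / ((M + x) ^ 2 * R)
        ≤ 4 * M * x * (1 + |L|) / (M ^ 2 * (M ^ 2 / (2 * x))) := by gcongr
      _ = 8 / M ^ 3 * x ^ 2 * (1 + |L|) := by field_simp; ring
  have hsum : |x / (M + x) ^ 2 + 1 / R| ≤ 3 * x / M ^ 2 := by
    rw [abs_of_pos (by positivity)]
    calc x / (M + x) ^ 2 + 1 / R ≤ x / M ^ 2 + 1 / (M ^ 2 / (2 * x)) := by gcongr
      _ = 3 * x / M ^ 2 := by field_simp; ring
  rw [sq_sub_sq, abs_mul]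
  calc _ ≤ 3 * x / M ^ 2 * (8 / M ^ 3 * x ^ 2 * (1 + |L|)) := by gcongr
    _ = 24 / M ^ 5 * x ^ 3 * (1 + |L|) := by field_simp; ring


/-- Expansion `D r⁻² = 1/r_*² + O((r-M)³) log((r-M)⁻¹)` near the extremal event
horizon: with `D(r) = (1 - M/r)²` and the exterior tortoise coordinate `r_*`, for
`r` slightly bigger than `M` one has `r_*(r) ≤ -1` and
`|D(r)/r² - 1/r_*(r)²| ≤ C (r-M)³ (1 + |log(r-M)|)`. -/
theorem D_div_rsq_expansion_near_horizon
    (M : ℝ) (hM : 0 < M) :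
    ∃ C > (0 : ℝ), ∃ δ ∈ Set.Ioo (0 : ℝ) M, ∀ r ∈ Set.Ioo M (M + δ),
      r - M - M ^ 2 / (r - M) + 2 * M * Real.log ((r - M) / M) ≤ -1 ∧
      |(1 - M / r) ^ 2 / r ^ 2
          - 1 / (r - M - M ^ 2 / (r - M) + 2 * M * Real.log ((r - M) / M)) ^ 2|
        ≤ C * (r - M) ^ 3 * (1 + |Real.log (r - M)|) := by
  refine ⟨24 / M ^ 5 * (1 + |Real.log M|), by positivity, min (M / 2) (M ^ 2 / 2),
    ⟨by positivity, (min_le_left _ _).trans_lt (by linarith)⟩, ?_⟩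
  rintro r ⟨hr, hrδ⟩
  obtain ⟨x, rfl⟩ : ∃ x, r = M + x := ⟨r - M, by ring⟩
  have hx : 0 < x := by linarith
  have hxδ : x < min (M / 2) (M ^ 2 / 2) := by linarith
  have hxM : x ≤ M / 2 := (hxδ.trans_le (min_le_left _ _)).le
  have hxM2 : x ≤ M ^ 2 / 2 := (hxδ.trans_le (min_le_right _ _)).le
  rw [add_sub_cancel_left]
  have hL : Real.log (x / M) ≤ 0 :=
    Real.log_nonpos (by positivity) ((div_le_one hM).2 (by linarith))
  obtain ⟨hR, hbound⟩ := abs_sq_div_sub_one_div_sq_le hM hx hxM hL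
  have hlog : 1 + |Real.log (x / M)| ≤ (1 + |Real.log M|) * (1 + |Real.log x|) := by
    rw [Real.log_div hx.ne' hM.ne']
    nlinarith [abs_sub (Real.log x) (Real.log M),
      mul_nonneg (abs_nonneg (Real.log x)) (abs_nonneg (Real.log M))]
  constructor
  · have h1 : 1 ≤ M ^ 2 / (2 * x) := by
      rw [le_div_iff₀ (by positivity)]
      linarith
    linarith
  · have hD : (1 - M / (M + x)) ^ 2 / (M + x) ^ 2 = (x / (M + x) ^ 2) ^ 2 := by
      have : M + x ≠ 0 := by positivity
      field_simp
      ring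
    have hS : 1 / (x - M ^ 2 / x + 2 * M * Real.log (x / M)) ^ 2
        = (1 / (M ^ 2 / x - x - 2 * M * Real.log (x / M))) ^ 2 := by
      rw [one_div_pow, ← neg_sq]
      congr 2
      ring
    rw [hD, hS]
    calc _ ≤ 24 / M ^ 5 * x ^ 3 * (1 + |Real.log (x / M)|) := hbound
      _ ≤ 24 / M ^ 5 * x ^ 3 * ((1 + |Real.log M|) * (1 + |Real.log x|)) := by gcongr
      _ = 24 / M ^ 5 * (1 + |Real.log M|) * x ^ 3 * (1 + |Real.log x|) := by ring
end
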